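/- arXiv:0807.0115 — 2 statements merged into one kernel-verified Lean document; each statement's English description precedes it below -/
import Mathlib

section
/- Let S and T be two expanding piecewise C^{1+ε} maps of 𝒰 and let Θ be the conjugacy with T∘Θ = Θ∘S. If Θ is bi-Lipschitz (there exists c ≥ 1 with c^{-1}|ξ−η| ≤ |Θ(ξ)−Θ(η)| ≤ c|ξ−η| for all ξ, η ∈ 𝒰), then Θ is a C^{1+ε} diffeomorphism of 𝒰, i.e. Θ is continuously differentiable with nowhere vanishing, ε-Hölder continuous derivative, and the same holds for Θ^{-1}. -/
open Set Filter Topology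

noncomputable section

/-- The unit interval `𝒰 = [0,1]`. -/
abbrev UI : Set ℝ := Set.Icc 0 1

/-- An expanding piecewise `C^{1+ε}` map of the unit interval, presented through its
`d` increasing full inverse branches (ordered left to right, images covering `𝒰` with
pairwise disjoint interiors), each branch being a `C^{1+ε}` diffeomorphism onto its image
whose derivative is `ε`-Hölder continuous with values in `(0,1)`. -/
structure ExpMap (d : ℕ) (ε : ℝ) : Type where
  toFun : ℝ → ℝ
  branch : Fin d → ℝ → ℝ
  branchDeriv : Fin d → ℝ → ℝ
  maps_to : Set.MapsTo toFun UI UI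
  branch_maps_to : ∀ a, Set.MapsTo (branch a) UI UI
  branch_mono : ∀ a, StrictMonoOn (branch a) UI
  right_inv : ∀ a, ∀ ξ ∈ Set.Ico (0 : ℝ) 1, toFun (branch a ξ) = ξ
  map_one : toFun 1 = 1
  branch_hasDeriv : ∀ a, ∀ ξ ∈ UI, HasDerivWithinAt (branch a) (branchDeriv a ξ) UI ξ
  branchDeriv_mem : ∀ a, ∀ ξ ∈ UI, branchDeriv a ξ ∈ Set.Ioo (0 : ℝ) 1
  branchDeriv_holder : ∀ a, ∃ C > 0, ∀ ξ ∈ UI, ∀ η ∈ UI,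
      |branchDeriv a ξ - branchDeriv a η| ≤ C * |ξ - η| ^ ε
  ordered : ∀ a b : Fin d, a < b → ∀ ξ ∈ UI, ∀ η ∈ UI, branch a ξ ≤ branch b η
  cover : UI ⊆ ⋃ a, branch a '' UI

/-- The shift map on `Σ = {1,…,d}^ℕ` (`x n` represents the letter `x_{n+1}`). -/
def shift {d : ℕ} (x : ℕ → Fin d) : ℕ → Fin d := fun n => x (n + 1)

/-- The cylinder set `[x_1 … x_n]`. -/
def cyl {d : ℕ} (x : ℕ → Fin d) (n : ℕ) : Set (ℕ → Fin d) := {y | ∀ m < n, y m = x m}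

/-- Finite approximations `S_{x_1}^{-1} ∘ ⋯ ∘ S_{x_n}^{-1}(0)` to the coding map. -/
def approx {d : ℕ} {ε : ℝ} (S : ExpMap d ε) (x : ℕ → Fin d) (n : ℕ) : ℝ :=
  (List.range n).foldr (fun m ξ => S.branch (x m) ξ) 0

/-- The coding map `π_S : Σ → 𝒰`. -/
def proj {d : ℕ} {ε : ℝ} (S : ExpMap d ε) (x : ℕ → Fin d) : ℝ := ⨆ n, approx S x n

/-- The potential `φ(x) = log (S_{x_1}^{-1})'(π_S(σ x))` associated with `S`. -/
def pot {d : ℕ} {ε : ℝ} (S : ExpMap d ε) (x : ℕ → Fin d) : ℝ :=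
  Real.log (S.branchDeriv (x 0) (proj S (shift x)))

/-- Birkhoff sums `S_n f(x) = ∑_{m=0}^{n-1} f(σ^m x)`. -/
def birk {d : ℕ} (f : (ℕ → Fin d) → ℝ) (n : ℕ) (x : ℕ → Fin d) : ℝ :=
  ∑ m ∈ Finset.range n, f (shift^[m] x)

/-- The difference quotient `D_Θ(ξ, η) = (Θ(ξ) - Θ(η))/(ξ - η)`. -/
def DQ (Θ : ℝ → ℝ) (ξ η : ℝ) : ℝ := (Θ ξ - Θ η) / (ξ - η)

/-- `Θ` is the conjugacy between `S` and `T` : an increasing homeomorphism of `𝒰`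
with `T ∘ Θ = Θ ∘ S`. -/
def IsConjugacy {d : ℕ} {ε : ℝ} (S T : ExpMap d ε) (Θ : ℝ → ℝ) : Prop :=
  StrictMonoOn Θ UI ∧ ContinuousOn Θ UI ∧ Θ '' UI = UI ∧
    ∀ ξ ∈ UI, T.toFun (Θ ξ) = Θ (S.toFun ξ)

/-- `x` has an `i`-block of length `k` at the `n`-th level:
`x_{n+1} = ⋯ = x_{n+k} = i` and `x_{n+k+1} ≠ i`. -/
def HasBlock {d : ℕ} (x : ℕ → Fin d) (i : Fin d) (k n : ℕ) : Prop :=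
  (∀ m < k, x (n + m) = i) ∧ x (n + k) ≠ i

/-- `x` is eventually constant. -/
def EvConst {d : ℕ} (x : ℕ → Fin d) : Prop := ∃ N : ℕ, ∃ i : Fin d, ∀ n ≥ N, x n = i

/-- `Θ'(ξ)` exists in the generalised sense: `lim_{η→ξ} D_Θ(ξ,η)` exists in `[0,∞]`
(with one-sided limits at the boundary points). -/
def GenDeriv (Θ : ℝ → ℝ) (ξ : ℝ) : Prop :=
  (∃ L : ℝ, Filter.Tendsto (fun η => DQ Θ ξ η) (nhdsWithin ξ (UI \ {ξ})) (nhds L)) ∨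
    Filter.Tendsto (fun η => DQ Θ ξ η) (nhdsWithin ξ (UI \ {ξ})) Filter.atTop

namespace ExpMap

variable {d : ℕ} {ε : ℝ}

/-- The composition `S_{w_1}^{-1} ∘ ⋯ ∘ S_{w_n}^{-1}` of inverse branches along a finite word. -/
def word (S : ExpMap d ε) : List (Fin d) → ℝ → ℝ
  | [], x => x
  | a :: w, x => S.branch a (word S w x)

/-- The derivative of `ExpMap.word`, given by the chain rule. -/
def wordDeriv (S : ExpMap d ε) : List (Fin d) → ℝ → ℝ
  | [], _ => 1
  | a :: w, x => S.branchDeriv a (word S w x) * wordDeriv S w x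

/-- The length of the cylinder interval of a finite word. -/
def cylLength (S : ExpMap d ε) (w : List (Fin d)) : ℝ := S.word w 1 - S.word w 0

/-- The map `ExpMap.word` rescaled to an increasing homeomorphism of the unit interval. -/
def normWord (S : ExpMap d ε) (w : List (Fin d)) (x : ℝ) : ℝ :=
  (S.word w x - S.word w 0) / S.cylLength w

end ExpMap

theorem zero_mem_UI : (0 : ℝ) ∈ UI := ⟨le_rfl, zero_le_one⟩

theorem one_mem_UI : (1 : ℝ) ∈ UI := ⟨zero_le_one, le_rfl⟩

theorem continuousOn_of_holder {s : Set ℝ} {f : ℝ → ℝ} {ε C : ℝ} (hε : 0 < ε)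
    (h : ∀ x ∈ s, ∀ y ∈ s, |f x - f y| ≤ C * |x - y| ^ ε) : ContinuousOn f s := by
  intro x hx
  have hc : Continuous fun y : ℝ => C * |y - x| ^ ε :=
    continuous_const.mul
      ((continuous_id.sub continuous_const).abs.rpow_const fun _ => Or.inr hε.le)
  have h0 : Tendsto (fun y : ℝ => C * |y - x| ^ ε) (𝓝[s] x) (𝓝 0) := by
    have := (hc.tendsto x).mono_left (nhdsWithin_le_nhds (s := s))
    simpa [Real.zero_rpow hε.ne'] using this
  rw [ContinuousWithinAt, tendsto_iff_dist_tendsto_zero]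
  refine squeeze_zero' (Eventually.of_forall fun _ => dist_nonneg) ?_ h0
  filter_upwards [self_mem_nhdsWithin] with y hy
  rw [Real.dist_eq]
  exact h y hy x hx

/-- The mean value theorem on the unit interval with one-sided derivatives at the end points. -/
theorem exists_slope_eq_of_hasDerivWithinAt_UI {f f' : ℝ → ℝ}
    (h : ∀ x ∈ UI, HasDerivWithinAt f (f' x) UI x) {x y : ℝ} (hx : x ∈ UI) (hy : y ∈ UI) :
    ∃ z ∈ UI, |z - x| ≤ |y - x| ∧ f y - f x = f' z * (y - x) := by
  have key : ∀ {a b : ℝ}, a ∈ UI → b ∈ UI → a < b →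
      ∃ z ∈ Ioo a b, f b - f a = f' z * (b - a) := by
    intro a b ha hb hab
    have hsub : Icc a b ⊆ UI := Icc_subset_Icc ha.1 hb.2
    obtain ⟨z, hz, hz'⟩ := exists_hasDerivAt_eq_slope f f' hab
      (fun u hu => ((h u (hsub hu)).continuousWithinAt).mono hsub)
      (fun u hu => (h u (hsub (Ioo_subset_Icc_self hu))).hasDerivAt
        (Icc_mem_nhds (ha.1.trans_lt hu.1) (hu.2.trans_le hb.2)))
    refine ⟨z, hz, ?_⟩
    rw [hz', div_mul_cancel₀ _ (sub_pos.2 hab).ne']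
  rcases lt_trichotomy x y with hxy | rfl | hxy
  · obtain ⟨z, hz, e⟩ := key hx hy hxy
    refine ⟨z, ⟨hx.1.trans hz.1.le, hz.2.le.trans hy.2⟩, ?_, e⟩
    rw [abs_of_pos (sub_pos.2 hz.1), abs_of_pos (sub_pos.2 hxy)]
    linarith [hz.2]
  · exact ⟨x, hx, by simp, by simp⟩
  · obtain ⟨z, hz, e⟩ := key hy hx hxy
    refine ⟨z, ⟨hy.1.trans hz.1.le, hz.2.le.trans hx.2⟩, ?_, by linarith⟩
    rw [abs_of_neg (sub_neg.2 hz.2), abs_of_neg (sub_neg.2 hxy)]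
    linarith [hz.1]

/-- A function with a uniform first order Taylor bound of Hölder type is differentiable. -/
theorem hasDerivWithinAt_of_taylor_holder {s : Set ℝ} {f : ℝ → ℝ} {x m C ε : ℝ} (hε : 0 < ε)
    (h : ∀ y ∈ s, |f y - f x - m * (y - x)| ≤ C * |y - x| ^ ε * |y - x|) :
    HasDerivWithinAt f m s x := by
  have hc : Continuous fun y : ℝ => C * |y - x| ^ ε :=
    continuous_const.mul
      ((continuous_id.sub continuous_const).abs.rpow_const fun _ => Or.inr hε.le)
  have h0 : Tendsto (fun y : ℝ => C * |y - x| ^ ε) (𝓝[s] x) (𝓝 0) := by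
    have := (hc.tendsto x).mono_left (nhdsWithin_le_nhds (s := s))
    simpa [Real.zero_rpow hε.ne'] using this
  rw [hasDerivWithinAt_iff_isLittleO, Asymptotics.isLittleO_iff]
  intro δ hδ
  filter_upwards [h0.eventually (gt_mem_nhds hδ), self_mem_nhdsWithin] with y hy hys
  have h1 := h y hys
  rw [Real.norm_eq_abs, Real.norm_eq_abs, smul_eq_mul, mul_comm (y - x) m]
  exact h1.trans (mul_le_mul_of_nonneg_right hy.le (abs_nonneg _))

theorem exists_tendsto_hyperfilter_of_bounded {f : ℕ → ℝ} {a b : ℝ}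
    (h : ∀ n, f n ∈ Icc a b) : ∃ l, Tendsto f (hyperfilter ℕ : Filter ℕ) (𝓝 l) := by
  obtain ⟨l, -, hl⟩ := isCompact_Icc.ultrafilter_le_nhds ((hyperfilter ℕ).map f)
    (le_principal_iff.2 (Filter.mem_map.2 (Eventually.of_forall h)))
  exact ⟨l, hl⟩

theorem abs_log_sub_log_le {m a b : ℝ} (hm : 0 < m) (ha : m ≤ a) (hb : m ≤ b) :
    |Real.log a - Real.log b| ≤ m⁻¹ * |a - b| := by
  have key : ∀ {a b : ℝ}, m ≤ a → m ≤ b → Real.log a - Real.log b ≤ m⁻¹ * |a - b| := by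
    intro a b ha hb
    have ha0 := hm.trans_le ha
    have hb0 := hm.trans_le hb
    rw [← Real.log_div ha0.ne' hb0.ne']
    calc Real.log (a / b) ≤ a / b - 1 := Real.log_le_sub_one_of_pos (div_pos ha0 hb0)
      _ = b⁻¹ * (a - b) := by field_simp
      _ ≤ b⁻¹ * |a - b| := by gcongr; exact le_abs_self _
      _ ≤ m⁻¹ * |a - b| := by gcongr
  rw [abs_le]
  constructor
  · have := key hb ha
    rw [abs_sub_comm] at this
    linarith
  · exact key ha hb

theorem abs_exp_sub_exp_le {a b c : ℝ} (ha : a ≤ c) (hb : b ≤ c) :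
    |Real.exp a - Real.exp b| ≤ Real.exp c * |a - b| := by
  have key : ∀ {a b : ℝ}, a ≤ c → Real.exp a - Real.exp b ≤ Real.exp c * |a - b| := by
    intro a b ha
    have h1 : Real.exp a - Real.exp b = Real.exp a * (1 - Real.exp (b - a)) := by
      rw [mul_sub, ← Real.exp_add]; ring_nf
    rw [h1]
    have h2 : 1 - Real.exp (b - a) ≤ |a - b| := by
      have := Real.add_one_le_exp (b - a)
      have := le_abs_self (a - b)
      linarith
    calc _ ≤ Real.exp a * |a - b| := by gcongr
      _ ≤ _ := by gcongr
  rw [abs_le]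
  constructor
  · have := key (a := b) (b := a) hb
    rw [abs_sub_comm] at this
    linarith
  · exact key ha

namespace ExpMap

variable {d : ℕ} {ε : ℝ}

theorem nonempty_fin (S : ExpMap d ε) : Nonempty (Fin d) := by
  obtain ⟨a, -⟩ := mem_iUnion.1 (S.cover zero_mem_UI)
  exact ⟨a⟩

/-- Uniform expansion and Hölder constants of an expanding map. -/
theorem exists_uniform_bounds (hε : 0 < ε) (S : ExpMap d ε) :
    ∃ m l H : ℝ, 0 < m ∧ 0 < l ∧ l < 1 ∧ 0 < H ∧
      (∀ a, ∀ x ∈ UI, m ≤ S.branchDeriv a x ∧ S.branchDeriv a x ≤ l) ∧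
      ∀ a, ∀ x ∈ UI, ∀ y ∈ UI,
        |S.branchDeriv a x - S.branchDeriv a y| ≤ H * |x - y| ^ ε := by
  have := S.nonempty_fin
  choose C hC0 hC using S.branchDeriv_holder
  have hcont : ∀ a, ContinuousOn (S.branchDeriv a) UI := fun a =>
    continuousOn_of_holder hε (hC a)
  have hmax := fun a => isCompact_Icc.exists_isMaxOn ⟨0, zero_mem_UI⟩ (hcont a)
  have hmin := fun a => isCompact_Icc.exists_isMinOn ⟨0, zero_mem_UI⟩ (hcont a)
  choose u hu hu' using hmax
  choose v hv hv' using hmin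
  obtain ⟨a₁, h₁⟩ := Finite.exists_max fun a => S.branchDeriv a (u a)
  obtain ⟨a₂, h₂⟩ := Finite.exists_min fun a => S.branchDeriv a (v a)
  obtain ⟨a₃, h₃⟩ := Finite.exists_max C
  refine ⟨_, _, C a₃, (S.branchDeriv_mem a₂ _ (hv a₂)).1, (S.branchDeriv_mem a₁ _ (hu a₁)).1,
    (S.branchDeriv_mem a₁ _ (hu a₁)).2, hC0 a₃, ?_, ?_⟩
  · exact fun a x hx => ⟨(h₂ a).trans (hv' a hx), le_trans (hu' a hx) (h₁ a)⟩
  · exact fun a x hx y hy => (hC a x hx y hy).trans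
      (mul_le_mul_of_nonneg_right (h₃ a) (by positivity))

theorem word_mapsTo (S : ExpMap d ε) (w : List (Fin d)) : MapsTo (S.word w) UI UI := by
  induction w with
  | nil => exact fun x hx => hx
  | cons a w ih => exact fun x hx => S.branch_maps_to a (ih hx)

theorem word_strictMonoOn (S : ExpMap d ε) (w : List (Fin d)) : StrictMonoOn (S.word w) UI := by
  induction w with
  | nil => exact fun x _ y _ h => h
  | cons a w ih =>
    exact fun x hx y hy h =>
      S.branch_mono a (S.word_mapsTo w hx) (S.word_mapsTo w hy) (ih hx hy h)

theorem hasDerivWithinAt_word (S : ExpMap d ε) (w : List (Fin d)) :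
    ∀ x ∈ UI, HasDerivWithinAt (S.word w) (S.wordDeriv w x) UI x := by
  induction w with
  | nil => exact fun x _ => hasDerivWithinAt_id x UI
  | cons a w ih =>
    exact fun x hx => (S.branch_hasDeriv a _ (S.word_mapsTo w hx)).comp x (ih x hx)
      (S.word_mapsTo w)

theorem wordDeriv_pos (S : ExpMap d ε) (w : List (Fin d)) : ∀ x ∈ UI, 0 < S.wordDeriv w x := by
  induction w with
  | nil => exact fun x _ => zero_lt_one
  | cons a w ih =>
    exact fun x hx => mul_pos (S.branchDeriv_mem a _ (S.word_mapsTo w hx)).1 (ih x hx)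

theorem abs_word_sub_word_le (S : ExpMap d ε) {l : ℝ} (hl : 0 < l)
    (h : ∀ a, ∀ x ∈ UI, S.branchDeriv a x ≤ l) (w : List (Fin d)) {x y : ℝ}
    (hx : x ∈ UI) (hy : y ∈ UI) :
    |S.word w x - S.word w y| ≤ l ^ w.length * |x - y| := by
  induction w with
  | nil => simp [word]
  | cons a w ih =>
    obtain ⟨z, hz, -, e⟩ := exists_slope_eq_of_hasDerivWithinAt_UI (S.branch_hasDeriv a)
      (S.word_mapsTo w hy) (S.word_mapsTo w hx)
    rw [word, word, e, abs_mul, abs_of_pos (S.branchDeriv_mem a z hz).1, List.length_cons,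
      pow_succ', mul_assoc]
    exact mul_le_mul (h a z hz) ih (abs_nonneg _) hl.le

/-- Bounded distortion: the logarithms of the derivatives of all compositions of inverse
branches are uniformly Hölder. -/
theorem exists_distortion_bound (hε : 0 < ε) (S : ExpMap d ε) :
    ∃ C > 0, ∀ w : List (Fin d), ∀ x ∈ UI, ∀ y ∈ UI,
      |Real.log (S.wordDeriv w x) - Real.log (S.wordDeriv w y)| ≤ C * |x - y| ^ ε := by
  obtain ⟨m, l, H, hm, hl0, hl1, hH, hml, hH'⟩ := S.exists_uniform_bounds hε
  have hq0 : 0 < l ^ ε := Real.rpow_pos_of_pos hl0 _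
  have hq1 : l ^ ε < 1 := Real.rpow_lt_one hl0.le hl1 hε
  have hB : 0 < m⁻¹ * H := by positivity
  have main : ∀ w : List (Fin d), ∀ x ∈ UI, ∀ y ∈ UI,
      |Real.log (S.wordDeriv w x) - Real.log (S.wordDeriv w y)| ≤
        m⁻¹ * H * (∑ j ∈ Finset.range w.length, (l ^ ε) ^ j) * |x - y| ^ ε := by
    intro w x hx y hy
    induction w with
    | nil => simp [wordDeriv]
    | cons a w ih =>
      have hwx := S.word_mapsTo w hx
      have hwy := S.word_mapsTo w hy
      rw [wordDeriv, wordDeriv,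
        Real.log_mul (S.branchDeriv_mem a _ hwx).1.ne' (S.wordDeriv_pos w x hx).ne',
        Real.log_mul (S.branchDeriv_mem a _ hwy).1.ne' (S.wordDeriv_pos w y hy).ne',
        List.length_cons, Finset.sum_range_succ]
      have h1 := abs_log_sub_log_le hm (hml a _ hwx).1 (hml a _ hwy).1
      have h2 := hH' a _ hwx _ hwy
      have h3 : |S.word w x - S.word w y| ^ ε ≤ (l ^ ε) ^ w.length * |x - y| ^ ε := by
        calc |S.word w x - S.word w y| ^ ε ≤ (l ^ w.length * |x - y|) ^ ε :=
              Real.rpow_le_rpow (abs_nonneg _)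
                (S.abs_word_sub_word_le hl0 (fun a x hx => (hml a x hx).2) w hx hy) hε.le
          _ = (l ^ ε) ^ w.length * |x - y| ^ ε := by
              rw [Real.mul_rpow (by positivity) (abs_nonneg _), ← Real.rpow_natCast,
                ← Real.rpow_natCast, ← Real.rpow_mul hl0.le, ← Real.rpow_mul hl0.le, mul_comm ε]
      have h4 : |Real.log (S.branchDeriv a (S.word w x)) -
          Real.log (S.branchDeriv a (S.word w y))| ≤
          m⁻¹ * H * ((l ^ ε) ^ w.length * |x - y| ^ ε) :=
        calc _ ≤ _ := h1
          _ ≤ m⁻¹ * (H * |S.word w x - S.word w y| ^ ε) := by gcongr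
          _ ≤ m⁻¹ * (H * ((l ^ ε) ^ w.length * |x - y| ^ ε)) := by gcongr
          _ = _ := by ring
      calc _ = |(Real.log (S.branchDeriv a (S.word w x)) -
            Real.log (S.branchDeriv a (S.word w y))) +
            (Real.log (S.wordDeriv w x) - Real.log (S.wordDeriv w y))| := by congr 1; ring
        _ ≤ _ := (abs_add_le _ _).trans (add_le_add h4 ih)
        _ = _ := by ring
  refine ⟨m⁻¹ * H * (1 - l ^ ε)⁻¹, mul_pos hB (inv_pos.2 (sub_pos.2 hq1)), ?_⟩
  intro w x hx y hy
  refine (main w x hx y hy).trans ?_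
  gcongr
  rw [← tsum_geometric_of_lt_one hq0.le hq1]
  exact (summable_geometric_of_lt_one hq0.le hq1).sum_le_tsum _ fun i _ => by positivity

theorem cylLength_pos (S : ExpMap d ε) (w : List (Fin d)) : 0 < S.cylLength w :=
  sub_pos.2 (S.word_strictMonoOn w zero_mem_UI one_mem_UI zero_lt_one)

theorem normWord_mem (S : ExpMap d ε) (w : List (Fin d)) {x : ℝ} (hx : x ∈ UI) :
    S.normWord w x ∈ UI := by
  have h := (S.word_strictMonoOn w).monotoneOn
  refine ⟨div_nonneg (sub_nonneg.2 (h zero_mem_UI hx hx.1)) (S.cylLength_pos w).le, ?_⟩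
  rw [normWord, div_le_one (S.cylLength_pos w)]
  exact sub_le_sub_right (h hx one_mem_UI hx.2) _

theorem hasDerivWithinAt_normWord (S : ExpMap d ε) (w : List (Fin d)) (x : ℝ) (hx : x ∈ UI) :
    HasDerivWithinAt (S.normWord w) (S.wordDeriv w x / S.cylLength w) UI x :=
  ((S.hasDerivWithinAt_word w x hx).sub_const _).div_const _

/-- Rescaled compositions of inverse branches have derivatives that are uniformly bounded away
from `0` and `∞` and uniformly Hölder. -/
theorem exists_normWord_bounds (hε : 0 < ε) (S : ExpMap d ε) :
    ∃ K > 0, ∃ C > 0, ∀ w : List (Fin d),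
      (∀ x ∈ UI, S.wordDeriv w x / S.cylLength w ∈ Icc K⁻¹ K) ∧
      ∀ x ∈ UI, ∀ y ∈ UI,
        |S.wordDeriv w x / S.cylLength w - S.wordDeriv w y / S.cylLength w| ≤
          C * |x - y| ^ ε := by
  obtain ⟨C, hC, h⟩ := S.exists_distortion_bound hε
  refine ⟨Real.exp C, Real.exp_pos _, Real.exp C * C, by positivity, fun w => ?_⟩
  obtain ⟨z, hz, -, e⟩ := exists_slope_eq_of_hasDerivWithinAt_UI (S.hasDerivWithinAt_word w)
    zero_mem_UI one_mem_UI
  have hL : S.cylLength w = S.wordDeriv w z := by rw [cylLength, e]; ring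
  have hz0 := S.wordDeriv_pos w z hz
  have hlog : ∀ x ∈ UI, |Real.log (S.wordDeriv w x) - Real.log (S.wordDeriv w z)| ≤ C := by
    intro x hx
    refine (h w x hx z hz).trans (mul_le_of_le_one_right hC.le ?_)
    refine Real.rpow_le_one (abs_nonneg _) (abs_le.2 ⟨?_, ?_⟩) hε.le <;>
      linarith [hx.1, hx.2, hz.1, hz.2]
  have hexp : ∀ x ∈ UI, S.wordDeriv w x / S.cylLength w =
      Real.exp (Real.log (S.wordDeriv w x) - Real.log (S.wordDeriv w z)) := by
    intro x hx
    rw [Real.exp_sub, Real.exp_log (S.wordDeriv_pos w x hx), Real.exp_log hz0, hL]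
  constructor
  · intro x hx
    rw [hexp x hx, ← Real.exp_neg]
    exact ⟨Real.exp_le_exp.2 (abs_le.1 (hlog x hx)).1, Real.exp_le_exp.2 (abs_le.1 (hlog x hx)).2⟩
  · intro x hx y hy
    rw [hexp x hx, hexp y hy, mul_assoc]
    refine (abs_exp_sub_exp_le (abs_le.1 (hlog x hx)).2 (abs_le.1 (hlog y hy)).2).trans ?_
    rw [sub_sub_sub_cancel_right]
    exact mul_le_mul_of_nonneg_left (h w x hx y hy) (Real.exp_pos _).le

/-- Rescaled compositions of inverse branches along any sequence of words have a
`C^{1+ε}` limit along a nonprincipal ultrafilter. -/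
theorem exists_limit_normWord (hε : 0 < ε) (S : ExpMap d ε) (w : ℕ → List (Fin d)) :
    ∃ s s' : ℝ → ℝ, ∃ K > 0, ∃ C > 0,
      (∀ x ∈ UI, Tendsto (fun n => S.normWord (w n) x) (hyperfilter ℕ : Filter ℕ) (𝓝 (s x))) ∧
      (∀ x ∈ UI, HasDerivWithinAt s (s' x) UI x) ∧
      (∀ x ∈ UI, s' x ∈ Icc K⁻¹ K) ∧
      ∀ x ∈ UI, ∀ y ∈ UI, |s' x - s' y| ≤ C * |x - y| ^ ε := by
  obtain ⟨K, hK, C, hC, h⟩ := S.exists_normWord_bounds hε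
  have hs : ∀ x, ∃ l, x ∈ UI →
      Tendsto (fun n => S.normWord (w n) x) (hyperfilter ℕ : Filter ℕ) (𝓝 l) := by
    intro x
    by_cases hx : x ∈ UI
    · obtain ⟨l, hl⟩ := exists_tendsto_hyperfilter_of_bounded fun n => S.normWord_mem (w n) hx
      exact ⟨l, fun _ => hl⟩
    · exact ⟨0, fun h => absurd h hx⟩
  have hs' : ∀ x, ∃ l, x ∈ UI → Tendsto (fun n => S.wordDeriv (w n) x / S.cylLength (w n))
      (hyperfilter ℕ : Filter ℕ) (𝓝 l) := by
    intro x
    by_cases hx : x ∈ UI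
    · obtain ⟨l, hl⟩ := exists_tendsto_hyperfilter_of_bounded fun n => (h (w n)).1 x hx
      exact ⟨l, fun _ => hl⟩
    · exact ⟨0, fun h => absurd h hx⟩
  choose s hs using hs
  choose s' hs' using hs'
  refine ⟨s, s', K, hK, C, hC, hs, ?_, ?_, ?_⟩
  · intro x hx
    refine hasDerivWithinAt_of_taylor_holder (C := C) hε fun y hy => ?_
    refine le_of_tendsto ((((hs y hy).sub (hs x hx)).sub ((hs' x hx).mul_const (y - x))).abs)
      (Eventually.of_forall fun n => ?_)
    obtain ⟨z, hz, hzx, e⟩ := exists_slope_eq_of_hasDerivWithinAt_UI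
      (S.hasDerivWithinAt_normWord (w n)) hx hy
    rw [e, ← sub_mul, abs_mul]
    refine mul_le_mul_of_nonneg_right (((h (w n)).2 z hz x hx).trans ?_) (abs_nonneg _)
    exact mul_le_mul_of_nonneg_left (Real.rpow_le_rpow (abs_nonneg _) hzx hε.le) hC.le
  · exact fun x hx => isClosed_Icc.mem_of_tendsto (hs' x hx)
      (Eventually.of_forall fun n => (h (w n)).1 x hx)
  · exact fun x hx y hy => le_of_tendsto ((hs' x hx).sub (hs' y hy)).abs
      (Eventually.of_forall fun n => (h (w n)).2 x hx y hy)

theorem exists_word_eq (S : ExpMap d ε) (n : ℕ) :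
    ∀ ξ ∈ UI, ∃ w : List (Fin d), w.length = n ∧ ∃ x ∈ UI, S.word w x = ξ := by
  induction n with
  | zero => exact fun ξ hξ => ⟨[], rfl, ξ, hξ, rfl⟩
  | succ n ih =>
    intro ξ hξ
    obtain ⟨a, η, hη, rfl⟩ := mem_iUnion.1 (S.cover hξ)
    obtain ⟨w, hw, x, hx, rfl⟩ := ih η hη
    exact ⟨a :: w, by simp [hw], x, hx, rfl⟩

theorem tendsto_cylLength (hε : 0 < ε) (S : ExpMap d ε) {w : ℕ → List (Fin d)}
    (hw : ∀ n, (w n).length = n) : Tendsto (fun n => S.cylLength (w n)) atTop (𝓝 0) := by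
  obtain ⟨m, l, H, -, hl0, hl1, -, hml, -⟩ := S.exists_uniform_bounds hε
  refine squeeze_zero (fun n => (S.cylLength_pos _).le) (fun n => ?_)
    (tendsto_pow_atTop_nhds_zero_of_lt_one hl0.le hl1)
  have := S.abs_word_sub_word_le hl0 (fun a x hx => (hml a x hx).2) (w n) one_mem_UI zero_mem_UI
  rw [hw n] at this
  rw [sub_zero, abs_one, mul_one] at this
  exact (le_abs_self _).trans this

/-- Every point other than `1` lies in the image of `[0,1)` under some branch. -/
theorem exists_branch_eq_of_lt_one (S : ExpMap d ε) {ξ : ℝ} (hξ : ξ ∈ Ico (0 : ℝ) 1) :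
    ∃ a, ∃ η ∈ Ico (0 : ℝ) 1, S.branch a η = ξ := by
  have hsub : Ioc ξ 1 ⊆ ⋃ a, S.branch a '' UI ∩ Ioi ξ := by
    intro y hy
    obtain ⟨a, ha⟩ := mem_iUnion.1 (S.cover ⟨hξ.1.trans hy.1.le, hy.2⟩)
    exact mem_iUnion.2 ⟨a, ha, hy.1⟩
  have hcl : ξ ∈ closure (Ioc ξ 1) := by
    rw [closure_Ioc hξ.2.ne]
    exact ⟨le_rfl, hξ.2.le⟩
  have h := closure_mono hsub hcl
  rw [closure_iUnion_of_finite] at h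
  obtain ⟨a, ha⟩ := mem_iUnion.1 h
  have hcomp : IsCompact (S.branch a '' UI) :=
    isCompact_Icc.image_of_continuousOn fun x hx => (S.branch_hasDeriv a x hx).continuousWithinAt
  obtain ⟨η, hη, rfl⟩ := closure_minimal inter_subset_left hcomp.isClosed ha
  obtain ⟨-, ⟨η', hη', rfl⟩, hlt⟩ := closure_nonempty_iff.1 ⟨_, ha⟩
  exact ⟨a, η, ⟨hη.1, (((S.branch_mono a).lt_iff_lt hη hη').1 hlt).trans_le hη'.2⟩, rfl⟩

end ExpMap

theorem ExpMap.branch_lt_branch {d : ℕ} {ε : ℝ} (S : ExpMap d ε) {a b : Fin d} (hab : a < b)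
    {x y : ℝ} (hx : x ∈ Ico (0 : ℝ) 1) (hy : y ∈ UI) : S.branch a x < S.branch b y :=
  (S.branch_mono a ⟨hx.1, hx.2.le⟩ one_mem_UI hx.2).trans_le
    (S.ordered a b hab 1 one_mem_UI y hy)

namespace IsConjugacy

variable {d : ℕ} {ε : ℝ} {S T : ExpMap d ε} {Θ : ℝ → ℝ}

theorem mapsTo (hΘ : IsConjugacy S T Θ) : MapsTo Θ UI UI := mapsTo_iff_image_subset.2 hΘ.2.2.1.le

theorem map_zero (hΘ : IsConjugacy S T Θ) : Θ 0 = 0 := by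
  have h0 : (0 : ℝ) ∈ Θ '' UI := by rw [hΘ.2.2.1]; exact zero_mem_UI
  obtain ⟨u, hu, e⟩ := h0
  exact le_antisymm (e ▸ hΘ.1.monotoneOn zero_mem_UI hu hu.1) (hΘ.mapsTo zero_mem_UI).1

theorem map_one (hΘ : IsConjugacy S T Θ) : Θ 1 = 1 := by
  have h1 : (1 : ℝ) ∈ Θ '' UI := by rw [hΘ.2.2.1]; exact one_mem_UI
  obtain ⟨u, hu, e⟩ := h1
  exact le_antisymm (hΘ.mapsTo one_mem_UI).2
    (e.symm.le.trans (hΘ.1.monotoneOn hu one_mem_UI hu.2))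

theorem mapsTo_Ico (hΘ : IsConjugacy S T Θ) {x : ℝ} (hx : x ∈ Ico (0 : ℝ) 1) :
    Θ x ∈ Ico (0 : ℝ) 1 :=
  ⟨(hΘ.mapsTo ⟨hx.1, hx.2.le⟩).1, hΘ.map_one ▸ hΘ.1 ⟨hx.1, hx.2.le⟩ one_mem_UI hx.2⟩

theorem map_branch_of_lt_one (hΘ : IsConjugacy S T Θ) (a : Fin d) {x : ℝ}
    (hx : x ∈ Ico (0 : ℝ) 1) : Θ (S.branch a x) = T.branch a (Θ x) := by
  have hxU : x ∈ UI := ⟨hx.1, hx.2.le⟩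
  have hex : ∀ a, ∃ b, Θ (S.branch a x) = T.branch b (Θ x) := by
    intro a
    have hSx : S.branch a x ∈ Ico (0 : ℝ) 1 :=
      ⟨(S.branch_maps_to a hxU).1, (S.branch_mono a hxU one_mem_UI hx.2).trans_le
        (S.branch_maps_to a one_mem_UI).2⟩
    obtain ⟨b, η, hη, e⟩ := T.exists_branch_eq_of_lt_one (hΘ.mapsTo_Ico hSx)
    have h := hΘ.2.2.2 _ (S.branch_maps_to a hxU)
    rw [← e, T.right_inv b η hη, S.right_inv a x hx] at h
    exact ⟨b, by rw [← e, h]⟩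
  choose b hb using hex
  have hmono : StrictMono b := by
    intro a a' haa'
    by_contra! hle
    have hlt := hΘ.1 (S.branch_maps_to a hxU) (S.branch_maps_to a' hxU)
      (S.branch_lt_branch haa' hx hxU)
    rw [hb, hb] at hlt
    rcases hle.lt_or_eq with h | h
    · exact absurd (T.ordered _ _ h _ (hΘ.mapsTo hxU) _ (hΘ.mapsTo hxU)) hlt.not_ge
    · rw [h] at hlt
      exact hlt.false
  rw [hb, hmono.apply_eq]

/-- The conjugacy intertwines the inverse branches. -/
theorem map_branch (hΘ : IsConjugacy S T Θ) (a : Fin d) :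
    ∀ x ∈ UI, Θ (S.branch a x) = T.branch a (Θ x) := by
  have hS : ContinuousOn (S.branch a) UI := fun x hx => (S.branch_hasDeriv a x hx).continuousWithinAt
  have hT : ContinuousOn (T.branch a) UI := fun x hx => (T.branch_hasDeriv a x hx).continuousWithinAt
  have h : EqOn (fun x => Θ (S.branch a x)) (fun x => T.branch a (Θ x)) (Ico 0 1) :=
    fun x hx => hΘ.map_branch_of_lt_one a hx
  exact h.of_subset_closure (hΘ.2.1.comp hS (S.branch_maps_to a)) (hT.comp hΘ.2.1 hΘ.mapsTo)
    Ico_subset_Icc_self (closure_Ico zero_ne_one).ge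

theorem map_word (hΘ : IsConjugacy S T Θ) (w : List (Fin d)) :
    ∀ x ∈ UI, Θ (S.word w x) = T.word w (Θ x) := by
  induction w with
  | nil => exact fun x _ => rfl
  | cons a w ih =>
    intro x hx
    rw [ExpMap.word, ExpMap.word, hΘ.map_branch a _ (S.word_mapsTo w hx), ih x hx]

end IsConjugacy

/-- At a point of differentiability, a function is asymptotically affine on shrinking intervals
around that point, relative to the length of the interval. -/
theorem tendsto_rescaled_sub_of_hasDerivWithinAt {s : Set ℝ} {f : ℝ → ℝ} {L ξ : ℝ} {p q r : ℕ → ℝ}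
    (hf : HasDerivWithinAt f L s ξ) (hp : ∀ n, p n ∈ s) (hr : ∀ n, r n ∈ s)
    (hpξ : ∀ n, ξ ∈ Icc (p n) (q n)) (hrn : ∀ n, r n ∈ Icc (p n) (q n)) (hpq : ∀ n, p n < q n)
    (h0 : Tendsto (fun n => q n - p n) atTop (𝓝 0)) :
    Tendsto (fun n => (f (r n) - f (p n)) / (q n - p n) - L * ((r n - p n) / (q n - p n)))
      atTop (𝓝 0) := by
  have aux : ∀ u : ℕ → ℝ, (∀ n, u n ∈ s) → (∀ n, |u n - ξ| ≤ q n - p n) →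
      ∀ δ > 0, ∀ᶠ n in atTop, |f (u n) - f ξ - (u n - ξ) * L| ≤ δ * (q n - p n) := by
    intro u hu huξ δ hδ
    have hlim : Tendsto u atTop (𝓝[s] ξ) := by
      refine tendsto_nhdsWithin_iff.2 ⟨?_, Eventually.of_forall hu⟩
      rw [tendsto_iff_dist_tendsto_zero]
      exact squeeze_zero (fun _ => dist_nonneg) huξ h0
    have h := (Asymptotics.isLittleO_iff.1 (hasDerivWithinAt_iff_isLittleO.1 hf)) hδ
    filter_upwards [hlim.eventually h] with n hn
    exact hn.trans (mul_le_mul_of_nonneg_left (huξ n) hδ.le)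
  rw [Metric.tendsto_nhds]
  intro δ hδ
  have hpa := aux p hp (fun n => abs_le.2 ⟨by linarith [(hpξ n).2], by linarith [(hpξ n).1, hpq n]⟩)
    (δ / 3) (by positivity)
  have hra := aux r hr (fun n => abs_le.2 ⟨by linarith [(hpξ n).2, (hrn n).1],
    by linarith [(hpξ n).1, (hrn n).2]⟩) (δ / 3) (by positivity)
  filter_upwards [hpa, hra] with n h1 h2
  have hpos := sub_pos.2 (hpq n)
  rw [Real.dist_eq, sub_zero, ← mul_div_assoc, ← sub_div, abs_div, abs_of_pos hpos,
    div_lt_iff₀ hpos]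
  have h3 : f (r n) - f (p n) - L * (r n - p n) =
      (f (r n) - f ξ - (r n - ξ) * L) - (f (p n) - f ξ - (p n - ξ) * L) := by ring
  rw [h3]
  have h4 := abs_sub (f (r n) - f ξ - (r n - ξ) * L) (f (p n) - f ξ - (p n - ξ) * L)
  have := mul_pos hδ hpos
  linarith

/-- If a conjugacy has a nonzero derivative at one point, then it is a quotient of two limits of
rescaled compositions of inverse branches. -/
theorem IsConjugacy.exists_comp_eq_of_hasDerivWithinAt {d : ℕ} {ε : ℝ} {S T : ExpMap d ε}
    {Θ : ℝ → ℝ} (hε : 0 < ε) (hΘ : IsConjugacy S T Θ) {L ξ : ℝ} (hξ : ξ ∈ UI) (hL : L ≠ 0)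
    (hd : HasDerivWithinAt Θ L UI ξ) :
    ∃ s s' t t' : ℝ → ℝ, ∃ K₁ > 0, ∃ C₁ > 0, ∃ K₂ > 0, ∃ C₂ > 0,
      ((∀ x ∈ UI, HasDerivWithinAt s (s' x) UI x) ∧ (∀ x ∈ UI, s' x ∈ Icc K₁⁻¹ K₁) ∧
        ∀ x ∈ UI, ∀ y ∈ UI, |s' x - s' y| ≤ C₁ * |x - y| ^ ε) ∧
      ((∀ x ∈ UI, HasDerivWithinAt t (t' x) UI x) ∧ (∀ x ∈ UI, t' x ∈ Icc K₂⁻¹ K₂) ∧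
        ∀ x ∈ UI, ∀ y ∈ UI, |t' x - t' y| ≤ C₂ * |x - y| ^ ε) ∧
      ∀ x ∈ UI, t (Θ x) = s x := by
  choose w hw z hz hzξ using fun n => S.exists_word_eq n ξ hξ
  obtain ⟨s, s', K₁, hK₁, C₁, hC₁, hs, hs1, hs2, hs3⟩ := S.exists_limit_normWord hε w
  obtain ⟨t, t', K₂, hK₂, C₂, hC₂, ht, ht1, ht2, ht3⟩ := T.exists_limit_normWord hε w
  refine ⟨s, s', t, t', K₁, hK₁, C₁, hC₁, K₂, hK₂, C₂, hC₂, ⟨hs1, hs2, hs3⟩, ⟨ht1, ht2, ht3⟩, ?_⟩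
  have hmem : ∀ {x}, x ∈ UI → ∀ n, S.word (w n) x ∈ Icc (S.word (w n) 0) (S.word (w n) 1) :=
    fun {x} hx n => ⟨(S.word_strictMonoOn (w n)).monotoneOn zero_mem_UI hx hx.1,
      (S.word_strictMonoOn (w n)).monotoneOn hx one_mem_UI hx.2⟩
  have key : ∀ x ∈ UI, Tendsto (fun n => (Θ (S.word (w n) x) - Θ (S.word (w n) 0)) /
      S.cylLength (w n) - L * S.normWord (w n) x) (hyperfilter ℕ : Filter ℕ) (𝓝 0) := by
    intro x hx
    exact (tendsto_rescaled_sub_of_hasDerivWithinAt hd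
      (fun n => S.word_mapsTo (w n) zero_mem_UI) (fun n => S.word_mapsTo (w n) hx)
      (fun n => hzξ n ▸ hmem (hz n) n) (hmem hx)
      (fun n => sub_pos.1 (S.cylLength_pos (w n))) (S.tendsto_cylLength hε hw)).mono_left
      Nat.hyperfilter_le_atTop
  have hratio : Tendsto (fun n => T.cylLength (w n) / S.cylLength (w n))
      (hyperfilter ℕ : Filter ℕ) (𝓝 L) := by
    have h := (key 1 one_mem_UI).add_const L
    rw [zero_add] at h
    refine h.congr fun n => ?_
    have h1 : S.normWord (w n) 1 = 1 := div_self (S.cylLength_pos (w n)).ne'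
    rw [hΘ.map_word _ _ zero_mem_UI, hΘ.map_word _ _ one_mem_UI, hΘ.map_zero, hΘ.map_one, h1,
      mul_one, sub_add_cancel]
    rfl
  intro x hx
  have h1 := (hratio.mul (ht (Θ x) (hΘ.mapsTo hx))).sub ((hs x hx).const_mul L)
  have h2 : L * t (Θ x) - L * s x = 0 := by
    refine tendsto_nhds_unique h1 ((key x hx).congr fun n => ?_)
    rw [hΘ.map_word _ _ hx, hΘ.map_word _ _ zero_mem_UI, hΘ.map_zero, ExpMap.normWord,
      ExpMap.normWord]
    have := (T.cylLength_pos (w n)).ne'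
    field_simp
  exact mul_left_cancel₀ hL (sub_eq_zero.1 h2)

/-- If `t ∘ Θ = s` with `s`, `t` of class `C^{1+ε}` and nonvanishing derivatives, then a Lipschitz
injection `Θ` is of class `C^{1+ε}`. -/
theorem exists_holder_deriv_of_comp_eq {Θ s s' t t' : ℝ → ℝ} {ε c K₁ K₂ C₁ C₂ : ℝ} (hε : 0 < ε)
    (hc : 0 < c) (hmaps : MapsTo Θ UI UI) (hinj : InjOn Θ UI)
    (hlip : ∀ x ∈ UI, ∀ y ∈ UI, |Θ x - Θ y| ≤ c * |x - y|)
    (hK₁ : 0 < K₁) (hC₁ : 0 < C₁) (hK₂ : 0 < K₂) (hC₂ : 0 < C₂)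
    (hs : ∀ x ∈ UI, HasDerivWithinAt s (s' x) UI x) (hs' : ∀ x ∈ UI, s' x ∈ Icc K₁⁻¹ K₁)
    (hsH : ∀ x ∈ UI, ∀ y ∈ UI, |s' x - s' y| ≤ C₁ * |x - y| ^ ε)
    (ht : ∀ x ∈ UI, HasDerivWithinAt t (t' x) UI x) (ht' : ∀ x ∈ UI, t' x ∈ Icc K₂⁻¹ K₂)
    (htH : ∀ x ∈ UI, ∀ y ∈ UI, |t' x - t' y| ≤ C₂ * |x - y| ^ ε)
    (hcomp : ∀ x ∈ UI, t (Θ x) = s x) :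
    ∃ Θ' : ℝ → ℝ, (∀ x ∈ UI, HasDerivWithinAt Θ (Θ' x) UI x) ∧ ContinuousOn Θ' UI ∧
      (∀ x ∈ UI, Θ' x ≠ 0) ∧
      ∃ C > 0, ∀ x ∈ UI, ∀ y ∈ UI, |Θ' x - Θ' y| ≤ C * |x - y| ^ ε := by
  have hs0 : ∀ x ∈ UI, 0 < s' x := fun x hx => (inv_pos.2 hK₁).trans_le (hs' x hx).1
  have ht0 : ∀ x ∈ UI, 0 < t' x := fun x hx => (inv_pos.2 hK₂).trans_le (ht' x hx).1
  have hΘc : ContinuousOn Θ UI :=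
    continuousOn_of_holder zero_lt_one fun x hx y hy => by
      simpa only [Real.rpow_one] using hlip x hx y hy
  have hH : ∀ x ∈ UI, ∀ y ∈ UI, |s' x / t' (Θ x) - s' y / t' (Θ y)| ≤
      (K₂ * C₁ + K₁ * K₂ * K₂ * C₂ * c ^ ε) * |x - y| ^ ε := by
    intro x hx y hy
    have hx0 := ht0 _ (hmaps hx)
    have hy0 := ht0 _ (hmaps hy)
    have e : s' x / t' (Θ x) - s' y / t' (Θ y) =
        (t' (Θ x))⁻¹ * (s' x - s' y) +
          s' y * (t' (Θ x))⁻¹ * (t' (Θ y))⁻¹ * (t' (Θ y) - t' (Θ x)) := by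
      field_simp
      ring
    have hi : ∀ u ∈ UI, (t' u)⁻¹ ≤ K₂ := fun u hu => inv_le_of_inv_le₀ hK₂ (ht' u hu).1
    have h1 : |(t' (Θ x))⁻¹ * (s' x - s' y)| ≤ K₂ * (C₁ * |x - y| ^ ε) := by
      rw [abs_mul, abs_of_pos (inv_pos.2 hx0)]
      exact mul_le_mul (hi _ (hmaps hx)) (hsH x hx y hy) (abs_nonneg _) hK₂.le
    have h2 : |t' (Θ y) - t' (Θ x)| ≤ C₂ * (c ^ ε * |x - y| ^ ε) := by
      rw [← Real.mul_rpow hc.le (abs_nonneg _), abs_sub_comm]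
      refine (htH _ (hmaps hx) _ (hmaps hy)).trans ?_
      gcongr
      exact hlip x hx y hy
    have h3 : |s' y * (t' (Θ x))⁻¹ * (t' (Θ y))⁻¹ * (t' (Θ y) - t' (Θ x))| ≤
        K₁ * K₂ * K₂ * (C₂ * (c ^ ε * |x - y| ^ ε)) := by
      have := hs0 y hy
      rw [abs_mul, abs_of_pos (by positivity)]
      have h4 := (hs' y hy).2
      have h5 := hi _ (hmaps hx)
      have h6 := hi _ (hmaps hy)
      gcongr
    rw [e]
    refine (abs_add_le _ _).trans ((add_le_add h1 h3).trans_eq ?_)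
    ring
  refine ⟨fun x => s' x / t' (Θ x), ?_, continuousOn_of_holder hε hH,
    fun x hx => (div_pos (hs0 x hx) (ht0 _ (hmaps hx))).ne', _, by positivity, hH⟩
  intro x hx
  rw [hasDerivWithinAt_iff_tendsto_slope]
  have h1 := hasDerivWithinAt_iff_tendsto_slope.1 (hs x hx)
  have h2 := hasDerivWithinAt_iff_tendsto_slope.1 (ht _ (hmaps hx))
  have hlim : Tendsto Θ (𝓝[UI \ {x}] x) (𝓝[UI \ {Θ x}] (Θ x)) := by
    refine tendsto_nhdsWithin_iff.2
      ⟨(hΘc x hx).mono_left (nhdsWithin_mono _ sdiff_subset), ?_⟩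
    filter_upwards [self_mem_nhdsWithin] with y hy
    exact ⟨hmaps hy.1, fun h => hy.2 (hinj hy.1 hx h)⟩
  refine (h1.div (h2.comp hlim) (ht0 _ (hmaps hx)).ne').congr' ?_
  filter_upwards [self_mem_nhdsWithin] with y hy
  have hne : s y - s x ≠ 0 ∧ Θ y - Θ x ≠ 0 ∧ y - x ≠ 0 := by
    have hyx : y ≠ x := hy.2
    refine ⟨?_, sub_ne_zero.2 fun h => hyx (hinj hy.1 hx h), sub_ne_zero.2 hyx⟩
    obtain ⟨z, hz, -, e⟩ := exists_slope_eq_of_hasDerivWithinAt_UI hs hx hy.1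
    rw [e]
    exact mul_ne_zero (hs0 z hz).ne' (sub_ne_zero.2 hyx)
  obtain ⟨hn1, hn2, hn3⟩ := hne
  simp only [Pi.div_apply, Function.comp_apply, slope_def_field, hcomp y hy.1, hcomp x hx]
  field_simp

/-- A monotone function expanding distances by at least `m > 0` has a nonzero derivative at some
point of the unit interval. -/
theorem exists_hasDerivWithinAt_ne_zero {f : ℝ → ℝ} {m : ℝ} (hm : 0 < m) (hf : MonotoneOn f UI)
    (h : ∀ x ∈ UI, ∀ y ∈ UI, m * |x - y| ≤ |f x - f y|) :
    ∃ ξ ∈ UI, ∃ L ≠ 0, HasDerivWithinAt f L UI ξ := by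
  have hae := hf.ae_differentiableWithinAt_of_mem
  have hex : ∃ ξ ∈ UI, DifferentiableWithinAt ℝ f UI ξ := by
    by_contra! hcon
    have h0 : MeasureTheory.volume UI = 0 :=
      MeasureTheory.measure_mono_null (fun x hx => fun hd => hcon x hx (hd hx))
        (MeasureTheory.mem_ae_iff.1 hae)
    simp [UI] at h0
  obtain ⟨ξ, hξ, hd⟩ := hex
  refine ⟨ξ, hξ, _, ?_, hd.hasDerivWithinAt⟩
  have hlim := (hasDerivWithinAt_iff_tendsto_slope.1 hd.hasDerivWithinAt).abs
  have hne : (𝓝[UI \ {ξ}] ξ).NeBot :=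
    accPt_principal_iff_nhdsWithin.1 (uniqueDiffOn_Icc_zero_one ξ hξ).accPt
  have hle : m ≤ |derivWithin f UI ξ| := by
    refine ge_of_tendsto hlim ?_
    filter_upwards [self_mem_nhdsWithin] with y hy
    rw [slope_def_field, abs_div, le_div_iff₀ (abs_pos.2 (sub_ne_zero.2 hy.2))]
    exact h y hy.1 ξ hξ
  exact abs_pos.1 (hm.trans_le hle)

/-- If the conjugacy `Θ` between two expanding piecewise `C^{1+ε}`
maps is bi-Lipschitz, then `Θ` is a `C^{1+ε}` diffeomorphism of `𝒰`: it has a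
nowhere-vanishing, continuous, `ε`-Hölder derivative, and the same holds for `Θ⁻¹`. -/
theorem statement_12 {d : ℕ} {ε : ℝ} (hd : 2 ≤ d) (hε : 0 < ε)
    (S T : ExpMap d ε) (Θ : ℝ → ℝ) (hΘ : IsConjugacy S T Θ)
    (hbl : ∃ c : ℝ, 1 ≤ c ∧ ∀ ξ ∈ UI, ∀ η ∈ UI,
      c⁻¹ * |ξ - η| ≤ |Θ ξ - Θ η| ∧ |Θ ξ - Θ η| ≤ c * |ξ - η|) :
    ∃ Θ' : ℝ → ℝ,
      (∀ ξ ∈ UI, HasDerivWithinAt Θ (Θ' ξ) UI ξ) ∧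
      ContinuousOn Θ' UI ∧ (∀ ξ ∈ UI, Θ' ξ ≠ 0) ∧
      (∃ C > 0, ∀ ξ ∈ UI, ∀ η ∈ UI, |Θ' ξ - Θ' η| ≤ C * |ξ - η| ^ ε) ∧
      ∃ Ξ Ξ' : ℝ → ℝ,
        (∀ ξ ∈ UI, Ξ (Θ ξ) = ξ) ∧ (∀ η ∈ UI, Θ (Ξ η) = η) ∧
        (∀ η ∈ UI, HasDerivWithinAt Ξ (Ξ' η) UI η) ∧
        ContinuousOn Ξ' UI ∧ (∀ η ∈ UI, Ξ' η ≠ 0) ∧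
        (∃ C > 0, ∀ ξ ∈ UI, ∀ η ∈ UI, |Ξ' ξ - Ξ' η| ≤ C * |ξ - η| ^ ε) := by
  obtain ⟨c, hc1, hbl⟩ := hbl
  have hc : 0 < c := zero_lt_one.trans_le hc1
  obtain ⟨ξ, hξ, L, hL, hder⟩ := exists_hasDerivWithinAt_ne_zero (inv_pos.2 hc)
    hΘ.1.monotoneOn fun x hx y hy => (hbl x hx y hy).1
  obtain ⟨s, s', t, t', K₁, hK₁, C₁, hC₁, K₂, hK₂, C₂, hC₂, ⟨hs, hs', hsH⟩, ⟨ht, ht', htH⟩, hst⟩ :=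
    hΘ.exists_comp_eq_of_hasDerivWithinAt hε hξ hL hder
  have hmaps := hΘ.mapsTo
  have hinj : InjOn Θ UI := hΘ.1.injOn
  have hbij : BijOn Θ UI UI := ⟨hmaps, hinj, hΘ.2.2.1.ge⟩
  have hinv := hbij.invOn_invFunOn
  have hΞ : BijOn (Function.invFunOn Θ UI) UI UI := hbij.symm hinv.symm
  obtain ⟨Θ', h1, h2, h3, h4⟩ := exists_holder_deriv_of_comp_eq hε hc hmaps hinj
    (fun x hx y hy => (hbl x hx y hy).2) hK₁ hC₁ hK₂ hC₂ hs hs' hsH ht ht' htH hst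
  obtain ⟨Ξ', g1, g2, g3, g4⟩ := exists_holder_deriv_of_comp_eq (Θ := Function.invFunOn Θ UI)
    hε hc hΞ.mapsTo hΞ.injOn
    (fun x hx y hy => by
      have h := (hbl _ (hΞ.mapsTo hx) _ (hΞ.mapsTo hy)).1
      rwa [hinv.2 hx, hinv.2 hy, inv_mul_le_iff₀ hc] at h)
    hK₂ hC₂ hK₁ hC₁ ht ht' htH hs hs' hsH
    (fun x hx => by rw [← hst _ (hΞ.mapsTo hx), hinv.2 hx])
  exact ⟨Θ', h1, h2, h3, h4, Function.invFunOn Θ UI, Ξ', fun x hx => hinv.1 hx,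
    fun x hx => hinv.2 hx, g1, g2, g3, g4⟩
end
end

section
/- For every s ∈ ℝ, β_τ(s) is the unique real number β satisfying τ^s·2^{−β} + (1−τ)^s·2^{−β} = 1; one has β_τ(0) = 1 and β_τ(1) = 0; β_τ is strictly decreasing on ℝ; and if τ ≠ 1/2, then β_τ is strictly convex and there is a unique s₀ ∈ (0,1) with β_τ'(s₀) = −1, given explicitly by s₀ = ln( ln(1/(2τ)) / ln(2(1−τ)) ) / ln((1−τ)/τ). -/
noncomputable section

/-- The Salem pressure function `β_τ(s) := log₂(τ^s + (1-τ)^s)`. -/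
def betaTau (τ : ℝ) (s : ℝ) : ℝ := Real.logb 2 (τ ^ s + (1 - τ) ^ s)

section TwoTermPressure

variable {τ : ℝ}

lemma two_rpow_sum_pos (hτ : τ ∈ Set.Ioo (0 : ℝ) 1) (s : ℝ) : 0 < τ ^ s + (1 - τ) ^ s :=
  add_pos (Real.rpow_pos_of_pos hτ.1 s) (Real.rpow_pos_of_pos (sub_pos.2 hτ.2) s)

lemma betaTau_hasDerivAt (hτ : τ ∈ Set.Ioo (0 : ℝ) 1) (s : ℝ) :
    HasDerivAt (betaTau τ)
      ((τ ^ s * Real.log τ + (1 - τ) ^ s * Real.log (1 - τ)) / (τ ^ s + (1 - τ) ^ s)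
        / Real.log 2) s := by
  have h₁ : HasDerivAt (fun x : ℝ => τ ^ x) (τ ^ s * Real.log τ) s := by
    simpa [mul_comm] using (hasDerivAt_id s).const_rpow (a := τ) hτ.1
  have h₂ : HasDerivAt (fun x : ℝ => (1 - τ) ^ x) ((1 - τ) ^ s * Real.log (1 - τ)) s := by
    simpa [mul_comm] using (hasDerivAt_id s).const_rpow (a := 1 - τ) (sub_pos.2 hτ.2)
  exact ((h₁.add h₂).log (two_rpow_sum_pos hτ s).ne').div_const (Real.log 2)

lemma betaTau_eq_iff (hτ : τ ∈ Set.Ioo (0 : ℝ) 1) (s b : ℝ) :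
    τ ^ s * (2 : ℝ) ^ (-b) + (1 - τ) ^ s * (2 : ℝ) ^ (-b) = 1 ↔ b = betaTau τ s := by
  rw [← add_mul, Real.rpow_neg zero_le_two, mul_inv_eq_one₀ (Real.rpow_pos_of_pos two_pos b).ne',
    eq_comm, eq_comm (a := b)]
  exact (Real.logb_eq_iff_rpow_eq two_pos (by norm_num) (two_rpow_sum_pos hτ s)).symm

lemma betaTau_zero (τ : ℝ) : betaTau τ 0 = 1 := by
  norm_num [betaTau]

lemma betaTau_one (τ : ℝ) : betaTau τ 1 = 0 := by
  simp [betaTau]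

lemma betaTau_strictAnti (hτ : τ ∈ Set.Ioo (0 : ℝ) 1) : StrictAnti (betaTau τ) := fun s t hst =>
  Real.logb_lt_logb one_lt_two (two_rpow_sum_pos hτ t) <| add_lt_add
    (Real.rpow_lt_rpow_of_exponent_gt hτ.1 hτ.2 hst)
    (Real.rpow_lt_rpow_of_exponent_gt (sub_pos.2 hτ.2) (by linarith [hτ.1]) hst)

lemma rpow_cross_sub_mul_log_sub_pos {a b s t : ℝ} (ha : 0 < a) (hb : 0 < b) (hab : a ≠ b)
    (hst : s < t) : 0 < (a ^ t * b ^ s - a ^ s * b ^ t) * (Real.log a - Real.log b) := by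
  have key : ∀ {x y : ℝ}, 0 < x → x < y → x ^ t * y ^ s < x ^ s * y ^ t := by
    intro x y hx hxy
    have hy := hx.trans hxy
    have hpow := Real.rpow_lt_rpow hx.le hxy (sub_pos.2 hst)
    rw [← add_sub_cancel s t, Real.rpow_add hx, Real.rpow_add hy]
    have := mul_pos (Real.rpow_pos_of_pos hx s) (Real.rpow_pos_of_pos hy s)
    nlinarith
  rcases hab.lt_or_gt with h | h
  · exact mul_pos_of_neg_of_neg (sub_neg.2 (key ha h)) (sub_neg.2 (Real.log_lt_log ha h))
  · exact mul_pos (by linarith [key hb h]) (sub_pos.2 (Real.log_lt_log hb h))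

lemma deriv_betaTau_strictMono (hτ : τ ∈ Set.Ioo (0 : ℝ) 1) (hne : τ ≠ 1 / 2) :
    StrictMono (deriv (betaTau τ)) := by
  intro s t hst
  rw [(betaTau_hasDerivAt hτ s).deriv, (betaTau_hasDerivAt hτ t).deriv]
  refine div_lt_div_of_pos_right ?_ (Real.log_pos one_lt_two)
  rw [div_lt_div_iff₀ (two_rpow_sum_pos hτ s) (two_rpow_sum_pos hτ t)]
  have hne' : τ ≠ 1 - τ := fun h => hne (by linarith)
  linarith [rpow_cross_sub_mul_log_sub_pos hτ.1 (sub_pos.2 hτ.2) hne' hst]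

lemma betaTau_strictConvexOn (hτ : τ ∈ Set.Ioo (0 : ℝ) 1) (hne : τ ≠ 1 / 2) :
    StrictConvexOn ℝ Set.univ (betaTau τ) :=
  (deriv_betaTau_strictMono hτ hne).strictConvexOn_univ_of_deriv
    (continuous_iff_continuousAt.2 fun s => (betaTau_hasDerivAt hτ s).continuousAt)

lemma eq_of_deriv_betaTau_eq_neg_one (hτ : τ ∈ Set.Ioo (0 : ℝ) 1) (hne : τ ≠ 1 / 2) {s : ℝ}
    (h : deriv (betaTau τ) s = -1) :
    s = Real.log (Real.log (1 / (2 * τ)) / Real.log (2 * (1 - τ))) /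
      Real.log ((1 - τ) / τ) := by
  have hσ : 0 < 1 - τ := sub_pos.2 hτ.2
  have hL : Real.log ((1 - τ) / τ) ≠ 0 :=
    Real.log_ne_zero_of_pos_of_ne_one (div_pos hσ hτ.1) fun h => hne (by
      rw [div_eq_one_iff_eq hτ.1.ne'] at h
      linarith)
  have hM : Real.log (2 * (1 - τ)) ≠ 0 :=
    Real.log_ne_zero_of_pos_of_ne_one (by positivity) fun h => hne (by linarith)
  have hq : Real.log (1 / (2 * τ)) / Real.log (2 * (1 - τ)) = ((1 - τ) / τ) ^ s := by
    rw [(betaTau_hasDerivAt hτ s).deriv, div_eq_iff (Real.log_pos one_lt_two).ne',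
      div_eq_iff (two_rpow_sum_pos hτ s).ne'] at h
    rw [Real.div_rpow hσ.le hτ.1.le, div_eq_div_iff hM (Real.rpow_pos_of_pos hτ.1 s).ne',
      one_div, Real.log_inv, Real.log_mul two_ne_zero hτ.1.ne',
      Real.log_mul two_ne_zero hσ.ne']
    linarith
  rw [hq, Real.log_rpow (div_pos hσ hτ.1), mul_div_cancel_right₀ _ hL]

lemma exists_deriv_betaTau_eq_neg_one (hτ : τ ∈ Set.Ioo (0 : ℝ) 1) :
    ∃ s ∈ Set.Ioo (0 : ℝ) 1, deriv (betaTau τ) s = -1 := by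
  obtain ⟨s, hs, h⟩ := exists_deriv_eq_slope (betaTau τ) zero_lt_one
    (fun s _ => (betaTau_hasDerivAt hτ s).continuousAt.continuousWithinAt)
    (fun s _ => (betaTau_hasDerivAt hτ s).differentiableAt.differentiableWithinAt)
  exact ⟨s, hs, by simpa [betaTau_zero, betaTau_one] using h⟩

end TwoTermPressure

/-- The Salem family.  For `τ ∈ (0,1)`: `β_τ(s)` is the unique real
`β` with `τ^s·2^{-β} + (1-τ)^s·2^{-β} = 1`; `β_τ(0) = 1`, `β_τ(1) = 0`; `β_τ` is strictly
decreasing; and if `τ ≠ 1/2` then `β_τ` is strictly convex and there is a unique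
`s₀ ∈ (0,1)` with `β_τ'(s₀) = -1`, given by
`s₀ = ln(ln(1/(2τ))/ln(2(1-τ)))/ln((1-τ)/τ)`. -/
theorem statement_17 (τ : ℝ) (hτ : τ ∈ Set.Ioo (0 : ℝ) 1) :
    (∀ s b : ℝ, τ ^ s * (2 : ℝ) ^ (-b) + (1 - τ) ^ s * (2 : ℝ) ^ (-b) = 1 ↔ b = betaTau τ s) ∧
    betaTau τ 0 = 1 ∧ betaTau τ 1 = 0 ∧
    StrictAnti (betaTau τ) ∧
    (τ ≠ 1 / 2 →
      StrictConvexOn ℝ Set.univ (betaTau τ) ∧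
      ∃ s₀ ∈ Set.Ioo (0 : ℝ) 1, deriv (betaTau τ) s₀ = -1 ∧
        (∀ s ∈ Set.Ioo (0 : ℝ) 1, deriv (betaTau τ) s = -1 → s = s₀) ∧
        s₀ = Real.log (Real.log (1 / (2 * τ)) / Real.log (2 * (1 - τ))) /
          Real.log ((1 - τ) / τ)) := by
  refine ⟨betaTau_eq_iff hτ, betaTau_zero τ, betaTau_one τ, betaTau_strictAnti hτ, fun hne =>
    ⟨betaTau_strictConvexOn hτ hne, ?_⟩⟩
  obtain ⟨s₀, hs₀, h⟩ := exists_deriv_betaTau_eq_neg_one hτ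
  exact ⟨s₀, hs₀, h, fun s _ hs => (deriv_betaTau_strictMono hτ hne).injective (hs.trans h.symm),
    eq_of_deriv_betaTau_eq_neg_one hτ hne h⟩
end
end
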